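/- arXiv:2006.11616 — 2 statements merged into one kernel-verified Lean document; each statement's English description precedes it below -/
import Mathlib

section
/- Let 𝔸 be a locally compact second countable Abelian group with dual group Â, and let μ be a finite positive Borel measure on Â. Define the unitary representation V^μ of 𝔸 on L²(Â, μ) by (V^μ_a f)(χ) = χ(a)·f(χ). If F ⊆ L²(Â, μ) is a closed subspace invariant under V^μ_a for every a ∈ 𝔸, then there exists a Borel set Y ⊆ Â such that F = 1_Y · L²(Â, μ), i.e. F consists exactly of the functions in L²(Â, μ) vanishing μ-a.e. off Y. (Wiener Lemma) -/
open MeasureTheory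

namespace PontryaginDual

open BoundedContinuousFunction ComplexConjugate

section Topology

variable {A : Type*} [CommGroup A] [TopologicalSpace A] [LocallyCompactSpace A]
  [SecondCountableTopology A]

/-- The dual of a locally compact second countable group is Polish. -/
instance instPolishSpace : PolishSpace (PontryaginDual A) := by
  have : (uniformity Circle).IsCountablyGenerated :=
    inferInstanceAs (uniformity (Metric.sphere (0 : ℂ) 1)).IsCountablyGenerated
  exact (ContinuousMonoidHom.isClosedEmbedding_toContinuousMap A Circle).polishSpace

end Topology

section Characters

variable {A : Type*} [CommGroup A] [TopologicalSpace A]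

theorem continuous_coe_eval (a : A) : Continuous fun χ : PontryaginDual A => (χ a : ℂ) :=
  continuous_subtype_val.comp <| (continuous_eval_const (F := C(A, Circle)) a).comp
    (ContinuousMonoidHom.isInducing_toContinuousMap A Circle).continuous

/-- Evaluation at a point, as a bounded continuous function on the dual group. -/
noncomputable def evalBounded : A →* (PontryaginDual A →ᵇ ℂ) where
  toFun a := BoundedContinuousFunction.ofNormedAddCommGroup (fun χ => (χ a : ℂ))
    (continuous_coe_eval a) 1 fun χ => (Circle.norm_coe _).le
  map_one' := by ext χ; simp
  map_mul' a b := by ext χ; simp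

@[simp]
theorem evalBounded_apply (a : A) (χ : PontryaginDual A) : evalBounded a χ = (χ a : ℂ) := rfl

theorem star_evalBounded (a : A) : star (evalBounded a) = evalBounded a⁻¹ := by
  ext χ
  simp only [star_apply, evalBounded_apply, map_inv]
  exact (Circle.coe_inv_eq_conj _).symm

variable [LocallyCompactSpace A] [SecondCountableTopology A]
  [MeasurableSpace (PontryaginDual A)] [BorelSpace (PontryaginDual A)]

/-- A finite measure on the dual group is determined by its Fourier transform. -/
theorem measure_ext_of_integral_eval_eq {P Q : Measure (PontryaginDual A)}
    [IsFiniteMeasure P] [IsFiniteMeasure Q]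
    (h : ∀ a : A, ∫ χ, (χ a : ℂ) ∂P = ∫ χ, (χ a : ℂ) ∂Q) : P = Q := by
  set S : Set (PontryaginDual A →ᵇ ℂ) := (MonoidHom.mrange (evalBounded (A := A))
    : Set (PontryaginDual A →ᵇ ℂ))
  have hstar : S ∪ star S = S := by
    refine Set.union_eq_left.2 ?_
    rintro g ⟨a, ha⟩
    exact ⟨a⁻¹, by rw [← star_evalBounded, ha, star_star]⟩
  refine ext_of_forall_mem_subalgebra_integral_eq_of_polish (𝕜 := ℂ)
    (A := StarAlgebra.adjoin ℂ S) ?_ ?_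
  · intro χ ψ hne
    obtain ⟨a, ha⟩ : ∃ a, χ a ≠ ψ a := by
      by_contra! hall
      exact hne (PontryaginDual.ext hall)
    refine ⟨_, ⟨_, ⟨evalBounded a, StarAlgebra.subset_adjoin ℂ S ⟨a, rfl⟩, rfl⟩, rfl⟩, ?_⟩
    exact fun h => ha (Circle.coe_injective h)
  · intro g hg
    have hg' : g ∈ Submodule.span ℂ S := by
      rw [← StarSubalgebra.mem_toSubalgebra, StarAlgebra.adjoin_toSubalgebra, hstar,
        ← Subalgebra.mem_toSubmodule, Algebra.adjoin_eq_span, Submonoid.closure_eq] at hg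
      exact hg
    clear hg
    induction hg' using Submodule.span_induction with
    | mem g hg => obtain ⟨a, rfl⟩ := hg; exact h a
    | zero => simp
    | add f g _ _ hf hg =>
      simp only [BoundedContinuousFunction.add_apply]
      rw [integral_add (f.integrable P) (g.integrable P),
        integral_add (f.integrable Q) (g.integrable Q), hf, hg]
    | smul c g _ hg => simp only [BoundedContinuousFunction.smul_apply, integral_smul, hg]

theorem ae_eq_zero_of_integral_eval_mul_ofReal_eq_zero {μ : Measure (PontryaginDual A)}
    [IsFiniteMeasure μ] {h : PontryaginDual A → ℝ} (hh : Integrable h μ)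
    (hint : ∀ a : A, ∫ χ, (χ a : ℂ) * (h χ : ℂ) ∂μ = 0) : h =ᵐ[μ] 0 := by
  have hp : AEMeasurable (fun χ => (h χ).toNNReal) μ := hh.aemeasurable.real_toNNReal
  have hn : AEMeasurable (fun χ => (-h χ).toNNReal) μ := hh.neg.aemeasurable.real_toNNReal
  have hip := hh.real_toNNReal
  have hin := hh.neg.real_toNNReal
  have := isFiniteMeasure_withDensity_ofReal hh.2
  have := isFiniteMeasure_withDensity_ofReal hh.neg.2
  have hPQ : μ.withDensity (fun χ => ENNReal.ofReal (h χ)) =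
      μ.withDensity (fun χ => ENNReal.ofReal ((-h) χ)) := by
    refine measure_ext_of_integral_eval_eq fun a => ?_
    have hb {k : PontryaginDual A → ℝ} (hk : Integrable k μ) :
        Integrable (fun χ : PontryaginDual A => k χ • (χ a : ℂ)) μ := by
      refine hk.smul_bdd 1 ?_ (.of_forall fun χ => (Circle.norm_coe _).le)
      exact (continuous_coe_eval a).aestronglyMeasurable
    refine (integral_withDensity_eq_integral_smul₀ hp _).trans ?_
    refine Eq.trans ?_ (integral_withDensity_eq_integral_smul₀ hn _).symm
    refine sub_eq_zero.1 ((integral_sub (hb hip) (hb hin)).symm.trans (Eq.trans ?_ (hint a)))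
    refine integral_congr_ae (.of_forall fun χ => ?_)
    simp only [← sub_smul]
    simp [mul_comm]
  have := (withDensity_eq_iff_of_sigmaFinite hp.coe_nnreal_ennreal hn.coe_nnreal_ennreal).1 hPQ
  filter_upwards [this] with χ hχ
  have hχ' : (h χ).toNNReal = (-h χ).toNNReal := by exact_mod_cast hχ
  have h0 := max_zero_sub_eq_self (h χ)
  rw [← Real.coe_toNNReal', ← Real.coe_toNNReal', hχ', sub_self] at h0
  exact h0.symm

/-- An integrable function on the dual group with vanishing Fourier transform is zero. -/
theorem ae_eq_zero_of_integral_eval_mul_eq_zero {μ : Measure (PontryaginDual A)}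
    [IsFiniteMeasure μ] {h : PontryaginDual A → ℂ} (hh : Integrable h μ)
    (hint : ∀ a : A, ∫ χ, (χ a : ℂ) * h χ ∂μ = 0) : h =ᵐ[μ] 0 := by
  have hconj (a : A) : ∫ χ, (χ a : ℂ) * conj (h χ) ∂μ = 0 := by
    rw [← map_zero conj, ← hint a⁻¹, ← integral_conj]
    congr! 2 with χ
    rw [_root_.map_mul, map_inv, Circle.coe_inv_eq_conj, Complex.conj_conj]
  have hb {k : PontryaginDual A → ℂ} (hk : Integrable k μ) (a : A) :
      Integrable (fun χ : PontryaginDual A => (χ a : ℂ) * k χ) μ :=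
    hk.bdd_mul (c := 1) (continuous_coe_eval a).aestronglyMeasurable
      (.of_forall fun χ => (Circle.norm_coe _).le)
  have hc : Integrable (fun χ => conj (h χ)) μ := by
    simpa using Complex.conjCLE.toContinuousLinearMap.integrable_comp hh
  have hre : (fun χ => (h χ).re) =ᵐ[μ] 0 := by
    refine ae_eq_zero_of_integral_eval_mul_ofReal_eq_zero hh.re fun a => ?_
    have : ∀ χ : PontryaginDual A, (χ a : ℂ) * ((h χ).re : ℂ)
        = ((χ a : ℂ) * h χ + (χ a : ℂ) * conj (h χ)) / 2 := fun χ => by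
      rw [← mul_add, Complex.add_conj]; push_cast; ring
    simp only [this]
    rw [integral_div, integral_add (hb hh a) (hb hc a), hint, hconj]
    simp
  have him : (fun χ => (h χ).im) =ᵐ[μ] 0 := by
    refine ae_eq_zero_of_integral_eval_mul_ofReal_eq_zero hh.im fun a => ?_
    have : ∀ χ : PontryaginDual A, (χ a : ℂ) * ((h χ).im : ℂ)
        = ((χ a : ℂ) * h χ - (χ a : ℂ) * conj (h χ)) / (2 * Complex.I) := fun χ => by
      rw [← mul_sub, Complex.sub_conj]; push_cast; field_simp
    simp only [this]
    rw [integral_div, integral_sub (hb hh a) (hb hc a), hint, hconj]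
    simp
  filter_upwards [hre, him] with χ h1 h2
  exact Complex.ext h1 h2

/-- If a subspace of `L²` is invariant under multiplication by all evaluations, its elements are
almost everywhere disjointly supported from those of its orthogonal complement. -/
theorem ae_eq_zero_or_eq_zero_of_mem_orthogonal {μ : Measure (PontryaginDual A)} [IsFiniteMeasure μ]
    {F : Submodule ℂ (Lp ℂ 2 μ)}
    (hF : ∀ a : A, ∀ f : Lp ℂ 2 μ, f ∈ F → ∀ g : Lp ℂ 2 μ,
      (g : PontryaginDual A → ℂ) =ᵐ[μ] (fun χ => (χ a : ℂ) * f χ) → g ∈ F)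
    {f g : Lp ℂ 2 μ} (hf : f ∈ F) (hg : g ∈ Fᗮ) :
    ∀ᵐ χ ∂μ, f χ = 0 ∨ g χ = 0 := by
  have key : (fun χ => inner ℂ (g χ) (f χ)) =ᵐ[μ] 0 := by
    refine ae_eq_zero_of_integral_eval_mul_eq_zero (L2.integrable_inner g f) fun a => ?_
    have hmem : MemLp (fun χ : PontryaginDual A => (χ a : ℂ) * f χ) 2 μ := by
      refine (Lp.memLp f).of_le ?_ (.of_forall fun χ => by
        rw [norm_mul, Circle.norm_coe, one_mul])
      exact (continuous_coe_eval a).aestronglyMeasurable.mul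
        (Lp.aestronglyMeasurable f)
    have h0 := Submodule.inner_left_of_mem_orthogonal
      (hF a f hf hmem.toLp hmem.coeFn_toLp) hg
    rw [← h0, L2.inner_def]
    refine integral_congr_ae ?_
    filter_upwards [hmem.coeFn_toLp] with χ hχ
    rw [hχ]
    simp [mul_assoc]
  filter_upwards [key] with χ hχ
  simpa using hχ

end Characters

end PontryaginDual

/-- **Wiener Lemma.** Let `A` be a locally compact second countable Abelian group with
Pontryagin dual `Â`, and let `μ` be a finite positive Borel measure on `Â`.  The unitary
representation `V^μ` of `A` on `L²(Â, μ)` acts by `(V^μ_a f)(χ) = χ(a) · f(χ)`.  If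
`F ⊆ L²(Â, μ)` is a closed subspace invariant under every `V^μ_a`, then there is a Borel set
`Y ⊆ Â` such that `F` consists exactly of those functions of `L²(Â, μ)` vanishing
`μ`-a.e. off `Y`. -/
theorem wiener_lemma {A : Type*} [CommGroup A] [TopologicalSpace A] [IsTopologicalGroup A]
    [LocallyCompactSpace A] [SecondCountableTopology A]
    [MeasurableSpace (PontryaginDual A)] [BorelSpace (PontryaginDual A)]
    (μ : Measure (PontryaginDual A)) [IsFiniteMeasure μ]
    (F : Submodule ℂ (Lp ℂ 2 μ)) (hFclosed : IsClosed (F : Set (Lp ℂ 2 μ)))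
    (hFinv : ∀ a : A, ∀ f : Lp ℂ 2 μ, f ∈ F → ∀ g : Lp ℂ 2 μ,
      (g : PontryaginDual A → ℂ) =ᵐ[μ] (fun χ => (χ a : ℂ) * f χ) → g ∈ F) :
    ∃ Y : Set (PontryaginDual A), MeasurableSet Y ∧
      ∀ f : Lp ℂ 2 μ, f ∈ F ↔ ∀ᵐ χ ∂μ, χ ∉ Y → f χ = 0 := by
  have : CompleteSpace F := hFclosed.completeSpace_coe
  have h1 : MemLp (fun _ : PontryaginDual A => (1 : ℂ)) 2 μ := memLp_const 1
  obtain ⟨u, hu, v, hv, huv⟩ := F.exists_add_mem_mem_orthogonal h1.toLp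
  have hsum : ∀ᵐ χ ∂μ, u χ + v χ = 1 := by
    filter_upwards [h1.coeFn_toLp, Lp.coeFn_add u v] with χ h2 h3
    rw [← h2, huv, h3, Pi.add_apply]
  refine ⟨{χ | u χ ≠ 0}, ?_, fun f => ⟨fun hf => ?_, fun hf => ?_⟩⟩
  · exact (Lp.stronglyMeasurable u).measurable (measurableSet_singleton 0).compl
  · filter_upwards [hsum, PontryaginDual.ae_eq_zero_or_eq_zero_of_mem_orthogonal hFinv hf hv]
      with χ h2 h3 h4
    have hu0 : u χ = 0 := by simpa using h4
    refine h3.resolve_right fun h5 => ?_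
    simp [hu0, h5] at h2
  · obtain ⟨p, hp, q, hq, rfl⟩ := F.exists_add_mem_mem_orthogonal f
    have hq0 : q = 0 := by
      rw [Lp.eq_zero_iff_ae_eq_zero]
      filter_upwards [hf, hsum, Lp.coeFn_add p q,
        PontryaginDual.ae_eq_zero_or_eq_zero_of_mem_orthogonal hFinv hu hq,
        PontryaginDual.ae_eq_zero_or_eq_zero_of_mem_orthogonal hFinv hp hv] with χ h2 h3 h4 h5 h6
      simp only [Pi.zero_apply]
      refine h5.elim (fun hu0 => ?_) id
      have hp0 : p χ = 0 := h6.resolve_right fun h8 => by simp [hu0, h8] at h3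
      have := h2 (by simpa using hu0)
      rwa [h4, Pi.add_apply, hp0, zero_add] at this
    simpa [hq0] using hp
end

section
/- Let 𝔸 be a locally compact second countable Abelian group and let r: 𝔸 → ℂ be a continuous function. Then r is positive definite (i.e. for all N, all a₀,…,a_N ∈ 𝔸 and z₀,…,z_N ∈ ℂ one has Σ_{n,m=0}^N r(a_n − a_m) z_n z̄_m ≥ 0) if and only if there exists a unique finite positive Borel measure σ on the dual group Â such that r(a) = ∫_Â χ(a) dσ(χ) for every a ∈ 𝔸. (Bochner–Herglotz Theorem) -/
open MeasureTheory
open scoped ComplexOrder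

universe u

section

open WeakDual
open scoped CompactlySupported BoundedContinuousFunction

/-- A positive functional on a commutative C⋆-algebra is integration over the character space. -/
theorem exists_measure_of_state {B : Type*} [CommCStarAlgebra B]
    [MeasurableSpace (characterSpace ℂ B)] [BorelSpace (characterSpace ℂ B)]
    (ω : B →ₗ[ℂ] ℂ) (hω : ∀ b, 0 ≤ ω (star b * b)) :
    ∃ μ : Measure (characterSpace ℂ B), IsFiniteMeasure μ ∧ ∀ b, ω b = ∫ φ, φ b ∂μ := by
  let X := characterSpace ℂ B
  let g := gelfandStarTransform B
  let ι : C_c(X, ℝ) → C(X, ℂ) := fun f ↦ ⟨fun x ↦ (f x : ℂ), by fun_prop⟩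
  let Λ₀ : C_c(X, ℝ) →ₗ[ℝ] ℝ :=
    { toFun := fun f ↦ (ω (g.symm (ι f))).re
      map_add' := fun f₁ f₂ ↦ by
        have : ι (f₁ + f₂) = ι f₁ + ι f₂ := by ext x; simp [ι]
        simp [this]
      map_smul' := fun c f ↦ by
        have : ι (c • f) = (c : ℂ) • ι f := by ext x; simp [ι]
        simp [this] }
  have key : ∀ f : C_c(X, ℝ), 0 ≤ f → 0 ≤ ω (g.symm (ι f)) := by
    intro f hf
    let s : C(X, ℂ) := ⟨fun x ↦ (√(f x) : ℂ), by fun_prop⟩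
    have : ι f = star s * s := by
      ext x
      have : 0 ≤ f x := hf x
      simp [ι, s, ← Complex.ofReal_mul, Real.mul_self_sqrt this]
    rw [this, map_mul, map_star]
    exact hω _
  let Λ : C_c(X, ℝ) →ₚ[ℝ] ℝ := PositiveLinearMap.mk₀ Λ₀ fun f hf ↦ (key f hf).1
  have hΛ : ∀ f, ω (g.symm (ι f)) = Λ f := by
    intro f
    let p : C_c(X, ℝ) := ⟨⟨fun x ↦ max (f x) 0, by fun_prop⟩, .of_compactSpace _⟩
    let q : C_c(X, ℝ) := ⟨⟨fun x ↦ max (-f x) 0, by fun_prop⟩, .of_compactSpace _⟩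
    have hp : 0 ≤ p := fun x ↦ le_max_right _ _
    have hq : 0 ≤ q := fun x ↦ le_max_right _ _
    have hpq : ι f = ι p - ι q := by
      ext x
      simp only [ι, p, q, ContinuousMap.coe_mk, ContinuousMap.sub_apply,
        CompactlySupportedContinuousMap.coe_mk, ← Complex.ofReal_sub]
      exact congrArg _ (max_zero_sub_eq_self _).symm
    apply Complex.ext
    · rfl
    · rw [hpq, map_sub, map_sub, Complex.sub_im, ← (key p hp).2, ← (key q hq).2]
      simp
  refine ⟨RealRMK.rieszMeasure Λ, inferInstance, fun b ↦ ?_⟩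
  have hcont : Continuous fun φ : X ↦ φ b := (g b).continuous
  let f₁ : C_c(X, ℝ) := ⟨⟨fun x ↦ (x b).re, Complex.continuous_re.comp hcont⟩, .of_compactSpace _⟩
  let f₂ : C_c(X, ℝ) := ⟨⟨fun x ↦ (x b).im, Complex.continuous_im.comp hcont⟩, .of_compactSpace _⟩
  have hb : g b = ι f₁ + Complex.I • ι f₂ := by
    ext x
    simp [ι, f₁, f₂, g, mul_comm Complex.I, Complex.re_add_im]
  have hi : Integrable (fun φ : X ↦ φ b) (RealRMK.rieszMeasure Λ) :=
    hcont.integrable_of_hasCompactSupport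
      (.of_compactSpace _)
  have hωb : ω b = Λ f₁ + Complex.I * Λ f₂ := by
    rw [← g.symm_apply_apply b, hb, map_add, map_smul, map_add, map_smul, hΛ, hΛ, smul_eq_mul]
  rw [hωb, ← RealRMK.integral_rieszMeasure, ← RealRMK.integral_rieszMeasure,
    ← integral_re_add_im hi, mul_comm]
  rfl


namespace PontryaginDual

variable {A : Type*} [CommGroup A] [TopologicalSpace A]

theorem continuous_eval_const (a : A) : Continuous fun χ : PontryaginDual A ↦ χ a :=
  (ContinuousEvalConst.continuous_eval_const (F := C(A, Circle)) a).comp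
    (ContinuousMonoidHom.isInducing_toContinuousMap A Circle).continuous

/-- Evaluation of characters, as a homomorphism into the bounded continuous functions. -/
noncomputable def evalHom : A →* (PontryaginDual A →ᵇ ℂ) where
  toFun a := .ofNormedAddCommGroup (fun χ ↦ (χ a : ℂ))
    (continuous_subtype_val.comp (continuous_eval_const a)) 1 fun χ ↦ (Circle.norm_coe (χ a)).le
  map_one' := by
    ext χ
    exact congrArg ((↑) : Circle → ℂ) (_root_.map_one χ)
  map_mul' a b := by
    ext χ
    exact congrArg ((↑) : Circle → ℂ) (_root_.map_mul χ a b)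

theorem evalHom_apply (a : A) (χ : PontryaginDual A) : evalHom a χ = (χ a : ℂ) := rfl

theorem star_evalHom (a : A) : star (evalHom a) = evalHom a⁻¹ := by
  ext χ
  rw [BoundedContinuousFunction.star_apply, evalHom_apply, evalHom_apply, map_inv,
    Circle.coe_inv_eq_conj]
  rfl

instance [LocallyCompactSpace A] [SecondCountableTopology A] :
    SecondCountableTopology (PontryaginDual A) :=
  (ContinuousMonoidHom.isInducing_toContinuousMap A Circle).secondCountableTopology

instance [IsTopologicalGroup A] [LocallyCompactSpace A] [SecondCountableTopology A] :
    PolishSpace (PontryaginDual A) := by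
  let := IsTopologicalGroup.rightUniformSpace (PontryaginDual A)
  have : IsUniformGroup (PontryaginDual A) := isUniformGroup_of_commGroup
  have : CompleteSpace (PontryaginDual A) :=
    IsRightUniformGroup.completeSpace_of_weaklyLocallyCompactSpace
  have : (uniformity (PontryaginDual A)).IsCountablyGenerated :=
    IsUniformGroup.uniformity_countably_generated
  infer_instance

variable [MeasurableSpace (PontryaginDual A)] [BorelSpace (PontryaginDual A)]

/-- A finite measure on the dual group is determined by its Fourier transform. -/
theorem measure_ext [IsTopologicalGroup A] [LocallyCompactSpace A] [SecondCountableTopology A]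
    {σ τ : Measure (PontryaginDual A)} [IsFiniteMeasure σ] [IsFiniteMeasure τ]
    (h : ∀ a : A, ∫ χ, evalHom a χ ∂σ = ∫ χ, evalHom a χ ∂τ) :
    σ = τ := by
  have hspan : (Algebra.adjoin ℂ (Set.range (evalHom (A := A)))).toSubmodule =
      Submodule.span ℂ (Set.range (evalHom (A := A))) := by
    rw [Algebra.adjoin_eq_span, ← MonoidHom.coe_mrange, Submonoid.closure_eq]
  let S : StarSubalgebra ℂ (PontryaginDual A →ᵇ ℂ) :=
    { Algebra.adjoin ℂ (Set.range (evalHom (A := A))) with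
      star_mem' := fun {f} hf ↦ by
        change f ∈ (Algebra.adjoin ℂ (Set.range (evalHom (A := A)))).toSubmodule at hf
        change star f ∈ (Algebra.adjoin ℂ (Set.range (evalHom (A := A)))).toSubmodule
        rw [hspan] at hf ⊢
        induction hf using Submodule.span_induction with
        | mem f hf =>
          obtain ⟨a, rfl⟩ := hf
          exact star_evalHom a ▸ Submodule.subset_span ⟨a⁻¹, rfl⟩
        | zero => simp
        | add f g _ _ hf hg => simpa using add_mem hf hg
        | smul c f _ hf => simpa using Submodule.smul_mem _ _ hf }
  refine ext_of_forall_mem_subalgebra_integral_eq_of_polish (A := S) ?_ fun g hg ↦ ?_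
  · intro χ ψ hne
    obtain ⟨a, ha⟩ := DFunLike.ne_iff.1 hne
    refine ⟨_, ⟨_, ⟨evalHom a, Algebra.subset_adjoin ⟨a, rfl⟩, rfl⟩, rfl⟩, fun h ↦ ha ?_⟩
    exact Circle.coe_injective h
  · change g ∈ (Algebra.adjoin ℂ (Set.range (evalHom (A := A)))).toSubmodule at hg
    rw [hspan] at hg
    induction hg using Submodule.span_induction with
    | mem f hf =>
      obtain ⟨a, rfl⟩ := hf
      exact h a
    | zero => simp
    | add f g _ _ hf hg =>
      simp only [BoundedContinuousFunction.coe_add, Pi.add_apply]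
      rw [integral_add (f.integrable _) (g.integrable _),
        integral_add (f.integrable _) (g.integrable _), hf, hg]
    | smul c f _ hf =>
      simp only [BoundedContinuousFunction.coe_smul]
      rw [integral_smul, integral_smul, hf]

/-- The Fourier transform of a finite measure is positive definite. -/
theorem sum_integral_evalHom_nonneg {σ : Measure (PontryaginDual A)} [IsFiniteMeasure σ]
    {ι : Type*} [Fintype ι] (a : ι → A) (z : ι → ℂ) :
    0 ≤ ∑ n, ∑ m, (∫ χ, evalHom (a n * (a m)⁻¹) χ ∂σ) * z n * starRingEnd ℂ (z m) := by
  have hsum : ∑ n, ∑ m, (∫ χ, evalHom (a n * (a m)⁻¹) χ ∂σ) * z n * starRingEnd ℂ (z m) =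
      ∫ χ, ((‖∑ n, z n * evalHom (a n) χ‖ ^ 2 : ℝ) : ℂ) ∂σ := by
    simp_rw [← integral_mul_const]
    have hi (n m : ι) : Integrable (fun χ ↦ evalHom (a n * (a m)⁻¹) χ * z n * starRingEnd ℂ (z m))
        σ := (((evalHom _).integrable σ).mul_const _).mul_const _
    simp_rw [← integral_finsetSum _ fun m _ ↦ hi _ m]
    rw [← integral_finsetSum _ fun n _ ↦ integrable_finsetSum _ fun m _ ↦ hi n m]
    refine integral_congr_ae (.of_forall fun χ ↦ ?_)
    simp only [Complex.ofReal_pow, ← Complex.mul_conj', map_sum, Finset.sum_mul_sum, _root_.map_mul]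
    refine Finset.sum_congr rfl fun n _ ↦ Finset.sum_congr rfl fun m _ ↦ ?_
    rw [← star_evalHom, BoundedContinuousFunction.mul_apply, BoundedContinuousFunction.star_apply,
      Complex.star_def]
    ring
  rw [hsum, integral_complex_ofReal]
  exact_mod_cast integral_nonneg fun _ ↦ by positivity

end PontryaginDual

theorem WeakDual.CharacterSpace.continuous_eval_prod {B : Type*} [CommCStarAlgebra B] :
    Continuous fun p : characterSpace ℂ B × B ↦ p.1 p.2 := by
  have hg : Continuous (gelfandTransform ℂ B) := (gelfandTransform_isometry B).continuous
  exact (hg.comp continuous_snd).eval continuous_fst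

theorem WeakDual.CharacterSpace.norm_apply_eq_one {B : Type*} [CommCStarAlgebra B]
    (φ : characterSpace ℂ B) {u : B} (hu : star u * u = 1) : ‖φ u‖ = 1 := by
  have h : star (φ u) * φ u = 1 := by rw [← map_star, ← map_mul, hu, map_one]
  have h' : ‖φ u‖ * ‖φ u‖ = 1 := by rw [← CStarRing.norm_star_mul_self, h, norm_one]
  nlinarith [norm_nonneg (φ u)]

open Filter Topology in
/-- A positive functional on a commutative C⋆-algebra, evaluated along a unitary representation of
`A`, is the Fourier transform of a finite measure as soon as the unit is approximated by elements
on which the representation is norm continuous. -/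
theorem exists_measure_of_state_comp {A : Type*} [CommGroup A] [TopologicalSpace A]
    [MeasurableSpace (PontryaginDual A)] [BorelSpace (PontryaginDual A)]
    {B : Type*} [CommCStarAlgebra B] (U : A →* B) (hU : ∀ a, star (U a) * U a = 1)
    (ω : B →ₗ[ℂ] ℂ) (hω : ∀ b, 0 ≤ ω (star b * b))
    (happrox : ∀ ε > 0, ∃ T : B, Continuous (fun a ↦ U a * T) ∧
      (ω (star (T - 1) * (T - 1))).re ≤ ε) :
    ∃ σ : Measure (PontryaginDual A), IsFiniteMeasure σ ∧
      ∀ a, ω (U a) = ∫ χ, PontryaginDual.evalHom a χ ∂σ := by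
  let : MeasurableSpace (characterSpace ℂ B) := borel _
  have : BorelSpace (characterSpace ℂ B) := ⟨rfl⟩
  obtain ⟨μ, _, hμ⟩ := exists_measure_of_state ω hω
  have hev : ∀ b : B, Continuous fun φ : characterSpace ℂ B ↦ φ b := fun b ↦
    CharacterSpace.continuous_eval_prod.comp (by fun_prop : Continuous fun φ ↦ (φ, b))
  let Y : Set (characterSpace ℂ B) := {φ | ∃ T : B, Continuous (fun a ↦ U a * T) ∧ φ T ≠ 0}
  have hYo : IsOpen Y := by
    have : Y = ⋃ T ∈ {T : B | Continuous (fun a ↦ U a * T)}, {φ | φ T ≠ 0} := by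
      ext φ; simp [Y]
    rw [this]
    exact isOpen_biUnion fun T _ ↦ isOpen_ne_fun (hev T) continuous_const
  have hYm : MeasurableSet Y := hYo.measurableSet
  have hY : μ Yᶜ = 0 := by
    rw [← measureReal_eq_zero_iff]
    refine le_antisymm (le_of_forall_pos_le_add fun ε hε ↦ ?_) measureReal_nonneg
    obtain ⟨T, hT, hTε⟩ := happrox ε hε
    have hint : Integrable (fun φ : characterSpace ℂ B ↦ ‖φ T - 1‖ ^ 2) μ :=
      (((hev T).sub continuous_const).norm.pow 2).integrable_of_hasCompactSupport
        (.of_compactSpace _)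
    have hre : (ω (star (T - 1) * (T - 1))).re = ∫ φ : characterSpace ℂ B, ‖φ T - 1‖ ^ 2 ∂μ := by
      rw [hμ, ← Complex.ofReal_re (∫ φ : characterSpace ℂ B, ‖φ T - 1‖ ^ 2 ∂μ),
        ← integral_complex_ofReal]
      congr 2
      ext φ
      rw [map_mul, map_star, map_sub, map_one, Complex.star_def, Complex.conj_mul']
      simp
    rw [zero_add]
    calc μ.real Yᶜ = ∫ φ in Yᶜ, (1 : ℝ) ∂μ := by simp
      _ ≤ ∫ φ in Yᶜ, ‖φ T - 1‖ ^ 2 ∂μ := by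
        refine setIntegral_mono_on (by simp) hint.integrableOn hYm.compl fun φ hφ ↦ ?_
        have : φ T = 0 := by_contra fun h ↦ hφ ⟨T, hT, h⟩
        simp [this]
      _ ≤ ∫ φ, ‖φ T - 1‖ ^ 2 ∂μ :=
        setIntegral_le_integral hint (.of_forall fun _ ↦ by positivity)
      _ ≤ ε := hre ▸ hTε
  have hcont : Continuous fun p : Y × A ↦ p.1.1 (U p.2) := by
    rw [continuous_iff_continuousAt]
    rintro ⟨⟨φ₀, T, hT, h₀⟩, a₀⟩
    have hnum : Continuous fun p : Y × A ↦ p.1.1 (U p.2 * T) :=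
      CharacterSpace.continuous_eval_prod.comp
        ((continuous_subtype_val.comp continuous_fst).prodMk (hT.comp continuous_snd))
    have hden : Continuous fun p : Y × A ↦ p.1.1 T :=
      (hev T).comp (continuous_subtype_val.comp continuous_fst)
    refine (hnum.continuousAt.div hden.continuousAt h₀).congr ?_
    filter_upwards [(isOpen_ne_fun hden continuous_const).mem_nhds h₀] with p hp
    rw [Pi.div_apply, map_mul, mul_div_cancel_right₀ _ hp]
  have hcirc : ∀ (φ : Y) (a : A), φ.1 (U a) ∈ Submonoid.unitSphere ℂ := fun φ a ↦ by
    simpa [Submonoid.unitSphere] using CharacterSpace.norm_apply_eq_one φ.1 (hU a)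
  let ψ : Y → PontryaginDual A := fun φ ↦
    ({ toFun := fun a ↦ (⟨φ.1 (U a), hcirc φ a⟩ : Circle)
       map_one' := Subtype.ext (by simp)
       map_mul' := fun a b ↦ Subtype.ext (by simp only [map_mul]; rfl)
       continuous_toFun := Continuous.subtype_mk
        (hcont.comp (by fun_prop : Continuous fun a ↦ (φ, a))) (hcirc φ) } : A →ₜ* Circle)
  have hψ : Continuous ψ :=
    ContinuousMonoidHom.continuous_of_continuous_uncurry _
      (Continuous.subtype_mk hcont fun p ↦ hcirc p.1 p.2)
  have hfin : IsFiniteMeasure (μ.comap ((↑) : Y → characterSpace ℂ B)) := by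
    constructor
    rw [comap_subtype_coe_apply hYm]
    exact measure_lt_top _ _
  refine ⟨(μ.comap ((↑) : Y → characterSpace ℂ B)).map ψ, inferInstance, fun a ↦ ?_⟩
  rw [integral_map hψ.measurable.aemeasurable
    (PontryaginDual.evalHom a).continuous.aestronglyMeasurable, hμ]
  change _ = ∫ φ : Y, φ.1 (U a) ∂_
  rw [integral_subtype_comap hYm fun φ : characterSpace ℂ B ↦ φ (U a),
    Measure.restrict_eq_self_of_ae_mem (measure_eq_zero_iff_ae_notMem.1 hY |>.mono (by simp))]

/-- The kernel `(x, y) ↦ r (x * y⁻¹)` is positive semidefinite. -/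
def IsPositiveDefiniteFun {A : Type*} [CommGroup A] (r : A → ℂ) : Prop :=
  ∀ (N : ℕ) (a : Fin N → A) (z : Fin N → ℂ),
    0 ≤ ∑ n : Fin N, ∑ m : Fin N, r (a n * (a m)⁻¹) * z n * (starRingEnd ℂ) (z m)

namespace IsPositiveDefiniteFun

variable {A : Type u} [CommGroup A] {r : A → ℂ}

theorem map_inv (h : IsPositiveDefiniteFun r) (a : A) : r a⁻¹ = starRingEnd ℂ (r a) := by
  have h0 := (h 1 ![1] ![1]).2
  have h1 := (h 2 ![1, a] ![1, 1]).2
  have h2 := (h 2 ![1, a] ![1, Complex.I]).2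
  simp [Fin.sum_univ_two] at h0 h1 h2
  apply Complex.ext <;> simp <;> linarith

theorem finsuppSum_nonneg (h : IsPositiveDefiniteFun r) (f : A →₀ ℂ) :
    0 ≤ f.sum fun y w ↦ f.sum fun x z ↦ r (x * y⁻¹) * z * starRingEnd ℂ w := by
  let e := f.support.equivFin.symm
  have := h _ (fun n ↦ e n) (fun n ↦ f (e n))
  rw [Finset.sum_comm] at this
  simp only [Finsupp.sum]
  rw [← Finset.sum_coe_sort, ← e.sum_comp]
  simp_rw [← Finset.sum_coe_sort f.support, ← e.sum_comp]
  exact this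

/-- The Gelfand-Naimark-Segal space of a positive definite function. -/
theorem exists_total_family (h : IsPositiveDefiniteFun r) :
    ∃ (H : Type u) (_ : NormedAddCommGroup H) (_ : InnerProductSpace ℂ H) (_ : CompleteSpace H)
      (δ : A → H), Dense (Submodule.span ℂ (Set.range δ) : Set H) ∧
        ∀ x y, inner ℂ (δ y) (δ x) = r (x * y⁻¹) := by
  let K : Matrix A A (ℂ →L[ℂ] ℂ) := .of fun x y ↦ r (y * x⁻¹) • 1
  have hK : K.PosSemidef := by
    have hiff := (RKHS.posSemidef_tfae (K := K)).out 0 2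
    refine hiff.2 ⟨?_, fun f ↦ ?_⟩
    · ext x y
      simp only [K, Matrix.conjTranspose_apply, Matrix.of_apply]
      rw [star_smul, star_one, Complex.star_def, ← h.map_inv]
      simp
    · refine (h.finsuppSum_nonneg f).1.trans_eq (congrArg Complex.re ?_)
      refine Finsupp.sum_congr fun y _ ↦ Finsupp.sum_congr fun x _ ↦ ?_
      simp [K, ← h.map_inv]
      ring
  have : Fact K.PosSemidef := ⟨hK⟩
  refine ⟨RKHS.OfKernel K, inferInstance, inferInstance, inferInstance,
    fun x ↦ RKHS.kerFun (RKHS.OfKernel K) x 1, ?_, fun x y ↦ ?_⟩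
  · rw [Submodule.dense_iff_topologicalClosure_eq_top, eq_top_iff, ← RKHS.kerFun_dense]
    refine Submodule.topologicalClosure_mono (Submodule.span_le.2 ?_)
    rintro _ ⟨x, v, rfl⟩
    have : RKHS.kerFun (RKHS.OfKernel K) x v = v • RKHS.kerFun (RKHS.OfKernel K) x 1 := by
      rw [← map_smul, smul_eq_mul, mul_one]
    rw [this]
    exact Submodule.smul_mem _ _ (Submodule.subset_span ⟨x, rfl⟩)
  · rw [← RKHS.kernel_inner, RKHS.OfKernel.kernel_ofKernel]
    simp [K, ← h.map_inv]

end IsPositiveDefiniteFun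

theorem exists_linearIsometry_of_inner_eq {ι H : Type*} [NormedAddCommGroup H]
    [InnerProductSpace ℂ H] [CompleteSpace H] {δ δ' : ι → H}
    (hδ : Dense (Submodule.span ℂ (Set.range δ) : Set H))
    (h : ∀ i j, inner ℂ (δ i) (δ j) = inner ℂ (δ' i) (δ' j)) :
    ∃ U : H →ₗᵢ[ℂ] H, ∀ i, U (δ i) = δ' i := by
  let e := Finsupp.linearCombination ℂ δ
  let f := Finsupp.linearCombination ℂ δ'
  have hd : DenseRange e := by
    rwa [DenseRange, ← LinearMap.coe_range, Finsupp.range_linearCombination]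
  have hn : ∀ x, ‖f x‖ = ‖e x‖ := by
    intro x
    rw [@norm_eq_sqrt_re_inner ℂ, @norm_eq_sqrt_re_inner ℂ]
    simp only [e, f, Finsupp.linearCombination_apply, Finsupp.sum_inner, Finsupp.inner_sum,
      inner_smul_left, inner_smul_right, h]
  have hext : ∀ x, f.extendOfNorm e (e x) = f x :=
    LinearMap.extendOfNorm_eq hd ⟨1, fun x ↦ by rw [hn, one_mul]⟩
  refine ⟨⟨(f.extendOfNorm e).toLinearMap, fun x ↦ ?_⟩, fun i ↦ ?_⟩
  · refine hd.induction_on x (isClosed_eq (by fun_prop) continuous_norm) fun y ↦ ?_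
    exact (congrArg norm (hext y)).trans (hn y)
  · simpa [e, f] using hext (Finsupp.single i 1)

/-- A continuous positive definite function is a matrix coefficient of a strongly continuous unitary
representation. -/
theorem IsPositiveDefiniteFun.exists_unitary_representation {A : Type u} [CommGroup A]
    [TopologicalSpace A] [IsTopologicalGroup A] {r : A → ℂ} (h : IsPositiveDefiniteFun r)
    (hr : Continuous r) :
    ∃ (H : Type u) (_ : NormedAddCommGroup H) (_ : InnerProductSpace ℂ H) (_ : CompleteSpace H)
      (U : A →* (H →L[ℂ] H)) (v : H), (∀ a, star (U a) * U a = 1) ∧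
        (∀ x, Continuous fun a ↦ U a x) ∧ ∀ a, inner ℂ v (U a v) = r a := by
  obtain ⟨H, _, _, _, δ, hδ, hin⟩ := h.exists_total_family
  have hex : ∀ a, ∃ V : H →ₗᵢ[ℂ] H, ∀ b, V (δ b) = δ (a * b) := fun a ↦
    exists_linearIsometry_of_inner_eq hδ fun i j ↦ by
      rw [hin, hin, mul_inv, mul_mul_mul_comm, mul_inv_cancel, one_mul]
  choose V hV using hex
  let U : A →* (H →L[ℂ] H) :=
    { toFun := fun a ↦ (V a).toContinuousLinearMap
      map_one' := ContinuousLinearMap.ext_on hδ (by rintro _ ⟨b, rfl⟩; simp [hV])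
      map_mul' := fun a b ↦
        ContinuousLinearMap.ext_on hδ (by rintro _ ⟨c, rfl⟩; simp [hV, mul_assoc]) }
  have hU : ∀ a b, U a (δ b) = δ (a * b) := hV
  have hnorm : ∀ a x, ‖U a x‖ = ‖x‖ := fun a x ↦ (V a).norm_map x
  refine ⟨H, inferInstance, inferInstance, inferInstance, U, δ 1,
    fun a ↦ (ContinuousLinearMap.norm_map_iff_adjoint_comp_self _).1 (hnorm a), fun x ↦ ?_,
    fun a ↦ by rw [hU, hin]; simp⟩
  have hδc : Continuous δ := by
    rw [continuous_iff_continuousAt]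
    intro a₀
    rw [ContinuousAt, tendsto_iff_norm_sub_tendsto_zero]
    have hsq : ∀ a, ‖δ a - δ a₀‖ = √(2 * (r 1).re - 2 * (r (a * a₀⁻¹)).re) := fun a ↦ by
      rw [← Real.sqrt_sq (norm_nonneg (δ a - δ a₀)), norm_sub_sq (𝕜 := ℂ), inner_re_symm, hin]
      rw [← inner_self_eq_norm_sq (𝕜 := ℂ), ← inner_self_eq_norm_sq (𝕜 := ℂ), hin, hin]
      simp only [mul_inv_cancel, RCLike.re_to_complex]
      ring_nf
    simp only [hsq]
    have hcont : Continuous fun a ↦ √(2 * (r 1).re - 2 * (r (a * a₀⁻¹)).re) := by fun_prop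
    simpa using hcont.tendsto a₀
  have hspan : ∀ x ∈ Submodule.span ℂ (Set.range δ), Continuous fun a ↦ U a x := by
    intro x hx
    induction hx using Submodule.span_induction with
    | mem x hx =>
      obtain ⟨b, rfl⟩ := hx
      simp only [hU]
      fun_prop
    | zero => simpa using continuous_const
    | add x y _ _ hx hy => simp only [map_add]; fun_prop
    | smul c x _ hx => simp only [map_smul]; fun_prop
  refine continuous_of_uniform_approx_of_continuous fun u hu ↦ ?_
  obtain ⟨ε, hε, hεu⟩ := Metric.mem_uniformity_dist.1 hu
  obtain ⟨y, hy, hxy⟩ := Metric.mem_closure_iff.1 (hδ x) ε hε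
  refine ⟨fun a ↦ U a y, hspan y hy, fun a ↦ hεu ?_⟩
  rwa [dist_eq_norm, ← map_sub, hnorm, ← dist_eq_norm]

open Topology in
/-- Averaging a strongly continuous unitary representation over a small neighbourhood of `1` gives
operators approximating the identity on which the representation acts norm continuously. -/
theorem exists_norm_continuous_mul_approx {A H : Type*} [CommGroup A] [TopologicalSpace A]
    [IsTopologicalGroup A] [LocallyCompactSpace A] [SecondCountableTopology A]
    [NormedAddCommGroup H] [InnerProductSpace ℂ H] [CompleteSpace H]
    (U : A →* (H →L[ℂ] H)) (hU : ∀ a, star (U a) * U a = 1)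
    (hc : ∀ x, Continuous fun a ↦ U a x) (v : H) {ε : ℝ} (hε : 0 < ε) :
    ∃ T : H →L[ℂ] H, Continuous (fun a ↦ U a * T) ∧
      (∀ S, (∀ a, Commute S (U a)) → Commute S T) ∧ ‖T v - v‖ ≤ ε := by
  let : MeasurableSpace A := borel A
  have : BorelSpace A := ⟨rfl⟩
  let μ : Measure A := Measure.haar
  have hnorm : ∀ a x, ‖U a x‖ = ‖x‖ := fun a ↦
    (ContinuousLinearMap.norm_map_iff_adjoint_comp_self _).2 (hU a)
  have hint : ∀ (F : Lp ℂ 1 μ) (x : H), Integrable (fun b ↦ F b • U b x) μ := fun F x ↦ by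
    refine ((L1.integrable_coeFn F).norm.mul_const ‖x‖).mono'
      ((L1.integrable_coeFn F).1.smul (hc x).aestronglyMeasurable) (.of_forall fun b ↦ ?_)
    rw [norm_smul, hnorm]
  have hbound : ∀ (F : Lp ℂ 1 μ) (x : H), ‖∫ b, F b • U b x ∂μ‖ ≤ ‖F‖ * ‖x‖ := fun F x ↦ by
    refine (norm_integral_le_integral_norm _).trans_eq ?_
    simp only [norm_smul, hnorm]
    rw [integral_mul_const, L1.norm_eq_integral_norm]
  let Φ : Lp ℂ 1 μ → (H →L[ℂ] H) := fun F ↦ LinearMap.mkContinuous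
    { toFun := fun x ↦ ∫ b, F b • U b x ∂μ
      map_add' := fun x y ↦ by
        simp only [map_add, smul_add]
        exact integral_add (hint F x) (hint F y)
      map_smul' := fun c x ↦ by
        simp only [map_smul, smul_comm _ c, RingHom.id_apply]
        exact integral_smul c _ } ‖F‖ (hbound F)
  have hΦ : ∀ F x, Φ F x = ∫ b, F b • U b x ∂μ := fun _ _ ↦ rfl
  have hΦc : Continuous Φ := by
    refine (LipschitzWith.of_dist_le_mul (K := 1) fun F G ↦ ?_).continuous
    rw [NNReal.coe_one, one_mul, dist_eq_norm, dist_eq_norm]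
    refine ContinuousLinearMap.opNorm_le_bound _ (norm_nonneg _) fun x ↦ ?_
    refine le_trans (le_of_eq ?_) (hbound (F - G) x)
    rw [sub_apply, hΦ, hΦ, ← integral_sub (hint F x) (hint G x)]
    refine congrArg norm (integral_congr_ae ?_)
    filter_upwards [Lp.coeFn_sub F G] with b hb
    rw [hb, Pi.sub_apply, sub_smul]
  have htrans : ∀ (a : A) (F : Lp ℂ 1 μ), U a * Φ F = Φ (DomMulAct.mk a⁻¹ • F) := by
    intro a F
    ext x
    rw [mul_apply_eq_comp, hΦ, hΦ, ← (U a).integral_comp_comm (hint F x),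
      ← integral_mul_left_eq_self _ a⁻¹]
    refine integral_congr_ae ?_
    filter_upwards [DomMulAct.smul_Lp_ae_eq (DomMulAct.mk a⁻¹) F] with b hb
    rw [hb, map_smul, ← mul_apply_eq_comp, ← map_mul]
    simp
  obtain ⟨K, hK, hK1⟩ := exists_compact_mem_nhds (1 : A)
  let s : Set A := interior K ∩ {b | ‖U b v - v‖ < ε}
  have hso : IsOpen s := isOpen_interior.inter (isOpen_lt (by fun_prop) continuous_const)
  have hs1 : (1 : A) ∈ s := ⟨mem_interior_iff_mem_nhds.2 hK1, by simpa using hε⟩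
  have hs0 : μ s ≠ 0 := (hso.measure_pos μ ⟨1, hs1⟩).ne'
  have hsT : μ s ≠ ⊤ :=
    ((measure_mono (Set.inter_subset_left.trans interior_subset)).trans_lt hK.measure_lt_top).ne
  let F : Lp ℂ 1 μ := indicatorConstLp 1 hso.measurableSet hsT ((μ.real s)⁻¹ : ℂ)
  refine ⟨Φ F, ?_, fun S hS ↦ ?_, ?_⟩
  · simp only [htrans]
    have : Fact ((1 : ENNReal) ≠ ⊤) := ⟨ENNReal.one_ne_top⟩
    have : Continuous fun a : A ↦ DomMulAct.mk a⁻¹ • F :=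
      (DomMulAct.continuous_mk.comp continuous_inv).smul continuous_const
    exact hΦc.comp this
  · ext x
    rw [mul_apply_eq_comp, mul_apply_eq_comp, hΦ, hΦ,
      ← S.integral_comp_comm (hint F x)]
    refine integral_congr_ae (.of_forall fun b ↦ ?_)
    simp only
    rw [map_smul, ← mul_apply_eq_comp, (hS b).eq, mul_apply_eq_comp]
  · have hav : Φ F v = ⨍ b in s, U b v ∂μ := by
      rw [hΦ, setAverage_eq, ← integral_indicator hso.measurableSet, ← integral_smul]
      refine integral_congr_ae ?_
      filter_upwards [indicatorConstLp_coeFn (p := 1) (hs := hso.measurableSet) (hμs := hsT)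
        (c := ((μ.real s)⁻¹ : ℂ))] with b hb
      rw [hb]
      by_cases hbs : b ∈ s
      · simp only [Set.indicator_of_mem hbs]
        rw [← Complex.ofReal_inv, Complex.coe_smul]
      · simp [hbs]
    rw [hav, ← dist_eq_norm, ← Metric.mem_closedBall]
    refine (convex_closedBall v ε).set_average_mem Metric.isClosed_closedBall hs0 hsT ?_ ?_
    · refine (ae_restrict_mem hso.measurableSet).mono fun b hb ↦ ?_
      rw [Metric.mem_closedBall, dist_eq_norm]
      exact hb.2.le
    · exact (integrableOn_const hsT).mono' (hc v).aestronglyMeasurable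
        (.of_forall fun b ↦ (hnorm b v).le)

theorem IsPositiveDefiniteFun.exists_measure {A : Type*} [CommGroup A] [TopologicalSpace A]
    [IsTopologicalGroup A] [LocallyCompactSpace A] [SecondCountableTopology A]
    [MeasurableSpace (PontryaginDual A)] [BorelSpace (PontryaginDual A)]
    {r : A → ℂ} (h : IsPositiveDefiniteFun r) (hr : Continuous r) :
    ∃ σ : Measure (PontryaginDual A), IsFiniteMeasure σ ∧
      ∀ a, r a = ∫ χ, PontryaginDual.evalHom a χ ∂σ := by
  obtain ⟨H, _, _, _, U, v, hU, hc, hv⟩ := h.exists_unitary_representation hr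
  have hstar : ∀ a, star (U a) = U a⁻¹ := fun a ↦ by
    have h1 : U a * U a⁻¹ = 1 := by rw [← map_mul, mul_inv_cancel, map_one]
    rw [← mul_one (star (U a)), ← h1, ← mul_assoc, hU, one_mul]
  have hrange : Set.range U ∪ star (Set.range U) = Set.range U := by
    refine Set.union_eq_self_of_subset_right ?_
    rintro T ⟨a, ha⟩
    exact ⟨a⁻¹, by rw [← hstar, ha, star_star]⟩
  let B := StarSubalgebra.centralizer ℂ
    (StarSubalgebra.centralizer ℂ (Set.range U) : Set (H →L[ℂ] H))
  have hBcoe : (B : Set (H →L[ℂ] H)) = (Set.range U).centralizer.centralizer := by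
    rw [StarSubalgebra.coe_centralizer_centralizer, hrange]
  have hmem : ∀ T, T ∈ B ↔ ∀ S, (∀ a, Commute S (U a)) → Commute S T := fun T ↦ by
    rw [← SetLike.mem_coe, hBcoe, Set.mem_centralizer_iff]
    simp only [Set.mem_centralizer_iff, Set.forall_mem_range, commute_iff_eq,
      eq_comm (a := U _ * _)]
  have hB : IsClosed (B : Set (H →L[ℂ] H)) := Set.isClosed_centralizer _
  have hcomm : ∀ S ∈ B, ∀ T ∈ B, S * T = T * S := by
    have := Set.centralizer_centralizer_comm_of_comm (S := Set.range U) <| by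
      rintro _ ⟨a, rfl⟩ _ ⟨b, rfl⟩
      rw [← map_mul, mul_comm, map_mul]
    rwa [← hBcoe] at this
  let : CommCStarAlgebra B :=
    { StarSubalgebra.cstarAlgebra B (h_closed := hB) with
      mul_comm := fun S T ↦ Subtype.ext (hcomm S S.2 T T.2) }
  let W : A →* B :=
    { toFun := fun a ↦ ⟨U a, (hmem _).2 fun S hS ↦ hS a⟩
      map_one' := Subtype.ext (map_one U)
      map_mul' := fun a b ↦ Subtype.ext (map_mul U a b) }
  let ω : B →ₗ[ℂ] ℂ :=
    { toFun := fun b ↦ inner ℂ v (b.1 v)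
      map_add' := fun b c ↦ inner_add_right _ _ _
      map_smul' := fun c b ↦ inner_smul_right _ _ _ }
  have hω : ∀ b, ω (star b * b) = ((‖b.1 v‖ ^ 2 : ℝ) : ℂ) := fun b ↦ by
    change inner ℂ v (star b.1 (b.1 v)) = _
    rw [ContinuousLinearMap.star_eq_adjoint, ContinuousLinearMap.adjoint_inner_right,
      inner_self_eq_norm_sq_to_K]
    simp
  obtain ⟨σ, hσ, hσr⟩ := exists_measure_of_state_comp W (fun a ↦ Subtype.ext (hU a)) ω
    (fun b ↦ by rw [hω]; exact Complex.zero_le_real.2 (sq_nonneg _)) fun ε hε ↦ by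
      obtain ⟨T, hT, hTS, hTv⟩ :=
        exists_norm_continuous_mul_approx U hU hc v (Real.sqrt_pos.2 hε)
      refine ⟨⟨T, (hmem T).2 hTS⟩, Continuous.subtype_mk hT _, ?_⟩
      rw [hω, Complex.ofReal_re, ← Real.sq_sqrt hε.le]
      exact pow_le_pow_left₀ (norm_nonneg _) hTv 2
  exact ⟨σ, hσ, fun a ↦ (hv a).symm.trans (hσr a)⟩

end

/-- **Bochner–Herglotz Theorem.** Let `A` be a locally compact second countable Abelian group
and `r : A → ℂ` a continuous function.  Then `r` is positive definite (for all `N`, all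
`a₀, …, a_N ∈ A` and `z₀, …, z_N ∈ ℂ` one has `Σ_{n,m} r(aₙ - aₘ) zₙ z̄ₘ ≥ 0`) if and only
if there exists a unique finite positive Borel measure `σ` on the Pontryagin dual of `A`
with `r a = ∫ χ(a) dσ(χ)` for every `a ∈ A`.  (The group is written multiplicatively, so
`aₙ - aₘ` becomes `aₙ * aₘ⁻¹`.) -/
theorem bochner_herglotz {A : Type*} [CommGroup A] [TopologicalSpace A] [IsTopologicalGroup A]
    [LocallyCompactSpace A] [SecondCountableTopology A]
    [MeasurableSpace (PontryaginDual A)] [BorelSpace (PontryaginDual A)]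
    (r : A → ℂ) (hr : Continuous r) :
    (∀ (N : ℕ) (a : Fin N → A) (z : Fin N → ℂ),
        0 ≤ ∑ n : Fin N, ∑ m : Fin N, r (a n * (a m)⁻¹) * z n * (starRingEnd ℂ) (z m)) ↔
      (∃! σ : Measure (PontryaginDual A), IsFiniteMeasure σ ∧
        ∀ a : A, r a = ∫ χ : PontryaginDual A, (χ a : ℂ) ∂σ) := by
  constructor
  · intro h
    obtain ⟨σ, hσ, hσr⟩ := IsPositiveDefiniteFun.exists_measure h hr
    refine ⟨σ, ⟨hσ, hσr⟩, fun τ ⟨hτ, hτr⟩ ↦ ?_⟩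
    exact PontryaginDual.measure_ext fun a ↦ (hτr a).symm.trans (hσr a)
  · rintro ⟨σ, ⟨hσ, hσr⟩, -⟩ N a z
    have h := PontryaginDual.sum_integral_evalHom_nonneg (σ := σ) a z
    simp only [hσr]
    exact h
end
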